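/- arXiv:1905.00147 — 3 statements merged into one kernel-verified Lean document; each statement's English description precedes it below -/
import Mathlib

section
/- Let n ≥ 1, let x_1, …, x_n ∈ ℝ^d, and let u : ℝ^d × ℝ → ℝ be such that for every x ∈ ℝ^d the function t ↦ u(x, t) is concave, differentiable, and has strictly positive derivative at every t ∈ ℝ. Let h* ∈ ℝⁿ be any allocation and set B = Σ_{i=1}^n h*_i. Then there exist welfare weights w_1, …, w_n > 0 with Σ_{i=1}^n w_i = 1 such that for every h ∈ ℝⁿ with Σ_{i=1}^n h_i ≤ B one has Σ_{i=1}^n w_i u(x_i, h_i) ≤ Σ_{i=1}^n w_i u(x_i, h*_i); that is, h* maximizes the weighted social welfare over all budget-feasible allocations. -/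
open scoped InnerProductSpace

/-- A concave differentiable function on `ℝ` lies below its tangent lines. -/
theorem ConcaveOn.le_tangent {f : ℝ → ℝ} (hf : ConcaveOn ℝ Set.univ f) {a : ℝ}
    (hd : DifferentiableAt ℝ f a) (b : ℝ) : f b ≤ f a + deriv f a * (b - a) := by
  rcases lt_trichotomy a b with hab | rfl | hab
  · have key := hf.slope_le_deriv (Set.mem_univ a) (Set.mem_univ b) hab hd
    rw [slope_def_field, div_le_iff₀ (sub_pos.2 hab)] at key
    linarith
  · simp
  · have key := hf.deriv_le_slope (Set.mem_univ b) (Set.mem_univ a) hab hd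
    rw [slope_def_field, le_div_iff₀ (sub_pos.2 hab)] at key
    linarith

/-- Any allocation `hstar` can be supported as the welfare-maximizing
allocation under the budget `B = ∑ i, hstar i` by a suitable choice of strictly positive
welfare weights summing to one, provided each individual utility `t ↦ u (x i) t` is
concave, differentiable, and has strictly positive derivative everywhere. -/
theorem planner_weights_exist
    (d n : ℕ) (hn : 1 ≤ n)
    (x : Fin n → EuclideanSpace ℝ (Fin d))
    (u : EuclideanSpace ℝ (Fin d) → ℝ → ℝ)
    (hconc : ∀ p : EuclideanSpace ℝ (Fin d), ConcaveOn ℝ Set.univ (u p))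
    (hdiff : ∀ p : EuclideanSpace ℝ (Fin d), Differentiable ℝ (u p))
    (hderiv : ∀ (p : EuclideanSpace ℝ (Fin d)) (t : ℝ), 0 < deriv (u p) t)
    (hstar : Fin n → ℝ) :
    ∃ w : Fin n → ℝ, (∀ i, 0 < w i) ∧ (∑ i, w i = 1) ∧
      ∀ h : Fin n → ℝ, (∑ i, h i) ≤ (∑ i, hstar i) →
        ∑ i, w i * u (x i) (h i) ≤ ∑ i, w i * u (x i) (hstar i) := by
  have : Nonempty (Fin n) := ⟨⟨0, hn⟩⟩
  set D : Fin n → ℝ := fun i => deriv (u (x i)) (hstar i)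
  have hDpos : ∀ i, 0 < D i := fun i => hderiv _ _
  set S : ℝ := ∑ i, (D i)⁻¹
  have hSpos : 0 < S :=
    Finset.sum_pos (fun i _ => inv_pos.2 (hDpos i)) Finset.univ_nonempty
  have hwpos : ∀ i, 0 < (D i)⁻¹ / S := fun i => div_pos (inv_pos.2 (hDpos i)) hSpos
  refine ⟨fun i => (D i)⁻¹ / S, hwpos, ?_, fun h hh => ?_⟩
  · rw [← Finset.sum_div, div_self hSpos.ne']
  · calc ∑ i, (D i)⁻¹ / S * u (x i) (h i)
        ≤ ∑ i, ((D i)⁻¹ / S * u (x i) (hstar i) + (h i - hstar i) / S) := by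
          refine Finset.sum_le_sum fun i _ => ?_
          have key := mul_le_mul_of_nonneg_left
            ((hconc (x i)).le_tangent (hdiff (x i) (hstar i)) (h i)) (hwpos i).le
          refine key.trans_eq ?_
          change _ * (_ + D i * _) = _
          have := (hDpos i).ne'
          field_simp
      _ = ∑ i, (D i)⁻¹ / S * u (x i) (hstar i) + (∑ i, h i - ∑ i, hstar i) / S := by
          rw [Finset.sum_add_distrib, ← Finset.sum_div, Finset.sum_sub_distrib]
      _ ≤ ∑ i, (D i)⁻¹ / S * u (x i) (hstar i) :=
          add_le_of_nonpos_right (div_nonpos_of_nonpos_of_nonneg (sub_nonpos.2 hh) hSpos.le)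
end

section
/- Let n ≥ 1, let x_1, …, x_n ∈ ℝ^d, and let u : ℝ^d × ℝ → ℝ be such that for every x ∈ ℝ^d the function t ↦ u(x, t) is concave, differentiable, and has strictly positive derivative at every t ∈ ℝ. Suppose w ∈ ℝⁿ with w_i ≥ 0 and Σ_{i=1}^n w_i = 1, and suppose h* ∈ ℝⁿ with B = Σ_{i=1}^n h*_i maximizes Σ_{i=1}^n w_i u(x_i, h_i) over {h ∈ ℝⁿ : Σ_{i=1}^n h_i ≤ B}. Let m_i > 0 denote the derivative of t ↦ u(x_i, t) at t = h*_i. Then w_i m_i = w_j m_j for all i, j ∈ {1, …, n}, and consequently w_i = (1/m_i) / (Σ_{j=1}^n 1/m_j) > 0 for every i; i.e., the supporting welfare weights have the form w_i = k/m_i for a positive constant k. -/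
open scoped InnerProductSpace

/-- Equality of marginals at a maximizer of a separable objective under a fixed total. -/
theorem hasDerivAt_eq_of_isMax_sum {ι : Type*} [Fintype ι] {f : ι → ℝ → ℝ} {f' a : ι → ℝ}
    (hf : ∀ k, HasDerivAt (f k) (f' k) (a k))
    (hmax : ∀ b : ι → ℝ, ∑ k, b k = ∑ k, a k → ∑ k, f k (b k) ≤ ∑ k, f k (a k)) (i j : ι) :
    f' i = f' j := by
  classical
  set c : ι → ℝ := Pi.single i 1 - Pi.single j 1 with hc
  have hc0 : ∑ k, c k = 0 := by simp [hc, Finset.sum_sub_distrib]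
  have hd : HasDerivAt (fun t : ℝ => ∑ k, f k (a k + t * c k)) (∑ k, f' k * c k) 0 := by
    refine HasDerivAt.fun_sum fun k _ => ?_
    have hline : HasDerivAt (fun t : ℝ => a k + t * c k) (c k) 0 := by
      simpa using ((hasDerivAt_id (0 : ℝ)).mul_const (c k)).const_add (a k)
    exact HasDerivAt.comp (0 : ℝ) (by simpa using hf k) hline
  have hloc : IsLocalMax (fun t : ℝ => ∑ k, f k (a k + t * c k)) 0 := by
    refine Filter.Eventually.of_forall fun t => ?_
    simpa using hmax (fun k => a k + t * c k)
      (by simp [Finset.sum_add_distrib, ← Finset.mul_sum, hc0])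
  have h0 := hloc.hasDerivAt_eq_zero hd
  simp only [hc, Pi.sub_apply, mul_sub, Finset.sum_sub_distrib, Pi.single_apply, mul_ite, mul_one,
    mul_zero, Finset.sum_ite_eq', Finset.mem_univ, if_true] at h0
  exact sub_eq_zero.mp h0

/-- Normalized weights that equalize `w i * m i` are proportional to `1 / m i`. -/
theorem eq_one_div_div_sum_of_mul_eq {ι : Type*} [Fintype ι] {w m : ι → ℝ}
    (hm : ∀ i, 0 < m i) (hw : ∑ i, w i = 1) (h : ∀ i j, w i * m i = w j * m j) (i : ι) :
    w i = (1 / m i) / ∑ j, 1 / m j := by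
  have hS : 0 < ∑ j, 1 / m j :=
    Finset.sum_pos (fun j _ => one_div_pos.mpr (hm j)) ⟨i, Finset.mem_univ i⟩
  have hterm (j : ι) : w i * (1 / m j) = w j * (1 / m i) := by
    have := (hm i).ne'
    have := (hm j).ne'
    field_simp
    linarith [h i j]
  rw [eq_div_iff hS.ne', Finset.mul_sum, Finset.sum_congr rfl fun j _ => hterm j,
    ← Finset.sum_mul, hw, one_mul]

/-- If `hstar` maximizes weighted social welfare over the budget set
`{h : ∑ i, h i ≤ ∑ i, hstar i}` under nonnegative weights `w` summing to one, and each
utility `t ↦ u (x i) t` is concave, differentiable, with strictly positive derivative,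
then the first-order condition `w i * m i = w j * m j` holds for the marginal utilities
`m i = deriv (u (x i)) (hstar i)`, and consequently `w i = (1 / m i) / (∑ j, 1 / m j) > 0`. -/
theorem planner_weights_form
    (d n : ℕ) (hn : 1 ≤ n)
    (x : Fin n → EuclideanSpace ℝ (Fin d))
    (u : EuclideanSpace ℝ (Fin d) → ℝ → ℝ)
    (hconc : ∀ p : EuclideanSpace ℝ (Fin d), ConcaveOn ℝ Set.univ (u p))
    (hdiff : ∀ p : EuclideanSpace ℝ (Fin d), Differentiable ℝ (u p))
    (hderiv : ∀ (p : EuclideanSpace ℝ (Fin d)) (t : ℝ), 0 < deriv (u p) t)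
    (w : Fin n → ℝ) (hw0 : ∀ i, 0 ≤ w i) (hw1 : ∑ i, w i = 1)
    (hstar : Fin n → ℝ)
    (hmax : ∀ h : Fin n → ℝ, (∑ i, h i) ≤ (∑ i, hstar i) →
      ∑ i, w i * u (x i) (h i) ≤ ∑ i, w i * u (x i) (hstar i)) :
    (∀ i j, w i * deriv (u (x i)) (hstar i) = w j * deriv (u (x j)) (hstar j)) ∧
    (∀ i, w i = (1 / deriv (u (x i)) (hstar i)) /
        (∑ j, 1 / deriv (u (x j)) (hstar j)) ∧ 0 < w i) := by
  have hfoc : ∀ i j, w i * deriv (u (x i)) (hstar i) = w j * deriv (u (x j)) (hstar j) :=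
    hasDerivAt_eq_of_isMax_sum (f := fun k t => w k * u (x k) t)
      (fun k => (hdiff (x k) (hstar k)).hasDerivAt.const_mul (w k)) fun b hb => hmax b hb.le
  have hm (i : Fin n) : 0 < deriv (u (x i)) (hstar i) := hderiv _ _
  refine ⟨hfoc, fun i => ?_⟩
  have hwi := eq_one_div_div_sum_of_mul_eq hm hw1 hfoc i
  refine ⟨hwi, ?_⟩
  rw [hwi]
  exact div_pos (one_div_pos.mpr (hm i))
    (Finset.sum_pos (fun j _ => one_div_pos.mpr (hm j)) ⟨i, Finset.mem_univ i⟩)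
end

section
/- Let n ≥ 1, let Q be a symmetric positive definite n × n real matrix, let q, y ∈ ℝⁿ, and let C > 0. Let K = {μ ∈ ℝⁿ : 0 ≤ μ_i ≤ C for all i, and Σ_{i=1}^n y_i μ_i = 0}, and for each ε ∈ ℝ let μ(ε) be the unique minimizer over K of f_ε(μ) = ½ μᵀQμ − Σ_{i=1}^n μ_i + ε qᵀμ. Then the solution path ε ↦ μ(ε) is continuous and piecewise affine: there exist finitely many breakpoints ε_1 < ε_2 < … < ε_K in ℝ such that on each of the intervals (−∞, ε_1], [ε_1, ε_2], …, [ε_K, ∞) (on all of ℝ if K = 0) the map ε ↦ μ(ε) agrees with an affine function of ε. -/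
open Matrix

/-- The dual feasible set: box constraints `0 ≤ μ_i ≤ C` and the equality
constraint `∑ i, y_i μ_i = 0`. -/
def DualFeasible (n : ℕ) (y : Fin n → ℝ) (C : ℝ) (μ : Fin n → ℝ) : Prop :=
  (∀ i, 0 ≤ μ i ∧ μ i ≤ C) ∧ ∑ i, y i * μ i = 0

/-- The parametric dual objective `f_ε(μ) = ½ μᵀQμ − ∑ μ_i + ε qᵀμ`. -/
noncomputable def dualObj (n : ℕ) (Q : Matrix (Fin n) (Fin n) ℝ) (q : Fin n → ℝ)
    (ε : ℝ) (μ : Fin n → ℝ) : ℝ :=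
  (1 / 2) * (μ ⬝ᵥ Q.mulVec μ) - ∑ i, μ i + ε * (q ⬝ᵥ μ)

/-- If every fibre of a map from `ℝ` to a finite type is order-connected, then the map is locally
constant away from finitely many points. -/
theorem exists_finset_forall_Ioo_eq {α : Type*} [Finite α] (p : ℝ → α)
    (h : ∀ s t, p s = p t → ∀ x ∈ Set.Icc s t, p x = p s) :
    ∃ T : Finset ℝ, ∀ a b : ℝ, (∀ t ∈ T, t ∉ Set.Ioo a b) →
      ∀ x ∈ Set.Ioo a b, ∀ z ∈ Set.Ioo a b, p x = p z := by
  classical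
  refine ⟨(Set.finite_range fun c => sSup (p ⁻¹' {c})).toFinset, fun a b hT => ?_⟩
  have key : ∀ x ∈ Set.Ioo a b, ∀ z ∈ Set.Ioo a b, x < z → p x = p z := by
    intro x hx z hz hxz
    by_contra hne
    have hub : ∀ w ∈ p ⁻¹' {p x}, w ≤ z := by
      intro w hw
      by_contra! hzw
      exact hne (h x w (Eq.symm hw) z ⟨hxz.le, hzw.le⟩).symm
    refine hT (sSup (p ⁻¹' {p x})) (by simp) ⟨?_, ?_⟩
    · exact hx.1.trans_le (le_csSup ⟨z, hub⟩ rfl)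
    · exact (csSup_le (s := p ⁻¹' {p x}) ⟨x, rfl⟩ hub).trans_lt hz.2
  intro x hx z hz
  rcases lt_trichotomy x z with hlt | rfl | hlt
  · exact key x hx z hz hlt
  · rfl
  · exact (key z hz x hx hlt).symm

/-- A continuous path that interpolates linearly between any two points of an open interval
is affine on the closed interval. -/
theorem exists_affine_on_Icc {n : ℕ} {f : ℝ → Fin n → ℝ} (hf : Continuous f) {a b : ℝ}
    (hab : a < b)
    (h : ∀ s ∈ Set.Ioo a b, ∀ t ∈ Set.Ioo a b, ∀ r ∈ Set.Icc (0 : ℝ) 1,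
      f (s + r * (t - s)) = f s + r • (f t - f s)) :
    ∃ c v : Fin n → ℝ, ∀ x ∈ Set.Icc a b, f x = fun i => c i + x * v i := by
  have hend : ∀ r ∈ Set.Icc (0 : ℝ) 1, f (a + r * (b - a)) = f a + r • (f b - f a) := by
    intro r hr
    have hclosed : IsClosed {p : ℝ × ℝ | f (p.1 + r * (p.2 - p.1)) =
        f p.1 + r • (f p.2 - f p.1)} := isClosed_eq (by fun_prop) (by fun_prop)
    have hsub : Set.Ioo a b ×ˢ Set.Ioo a b ⊆ {p : ℝ × ℝ | f (p.1 + r * (p.2 - p.1)) =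
        f p.1 + r • (f p.2 - f p.1)} := fun p hp => h p.1 hp.1 p.2 hp.2 r hr
    have hmem : (a, b) ∈ closure (Set.Ioo a b ×ˢ Set.Ioo a b) := by
      rw [closure_prod_eq, closure_Ioo hab.ne]
      exact ⟨Set.left_mem_Icc.2 hab.le, Set.right_mem_Icc.2 hab.le⟩
    exact closure_minimal hsub hclosed hmem
  have hba : 0 < b - a := sub_pos.2 hab
  refine ⟨fun i => f a i - a * ((f b i - f a i) / (b - a)),
    fun i => (f b i - f a i) / (b - a), fun x hx => ?_⟩
  have hx' := hend ((x - a) / (b - a))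
    ⟨div_nonneg (sub_nonneg.2 hx.1) hba.le, (div_le_one hba).2 (by linarith [hx.2])⟩
  rw [div_mul_cancel₀ _ hba.ne', add_sub_cancel] at hx'
  rw [hx']
  ext i
  simp only [Pi.add_apply, Pi.smul_apply, Pi.sub_apply, smul_eq_mul]
  field_simp
  ring

namespace DualFeasible

variable {n : ℕ} {y : Fin n → ℝ} {C : ℝ} {μ ν : Fin n → ℝ}

protected theorem zero (hC : 0 ≤ C) : DualFeasible n y C 0 := ⟨fun _ => ⟨le_rfl, hC⟩, by simp⟩

theorem sum_add_smul_sub (hμ : DualFeasible n y C μ) (hν : DualFeasible n y C ν) (r : ℝ) :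
    ∑ i, y i * (μ + r • (ν - μ)) i = 0 := by
  have : ∑ i, y i * (μ + r • (ν - μ)) i
      = ∑ i, y i * μ i + r * (∑ i, y i * ν i - ∑ i, y i * μ i) := by
    rw [← Finset.sum_sub_distrib, Finset.mul_sum, ← Finset.sum_add_distrib]
    refine Finset.sum_congr rfl fun i _ => ?_
    simp only [Pi.add_apply, Pi.smul_apply, Pi.sub_apply, smul_eq_mul]
    ring
  rw [this, hμ.2, hν.2]
  ring

theorem add_smul_sub (hμ : DualFeasible n y C μ) (hν : DualFeasible n y C ν) {r : ℝ}
    (hr : r ∈ Set.Icc (0 : ℝ) 1) : DualFeasible n y C (μ + r • (ν - μ)) := by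
  refine ⟨fun i => ?_, hμ.sum_add_smul_sub hν r⟩
  obtain ⟨h0, h1⟩ := hμ.1 i
  obtain ⟨h2, h3⟩ := hν.1 i
  simp only [Pi.add_apply, Pi.smul_apply, Pi.sub_apply, smul_eq_mul]
  constructor <;> nlinarith [hr.1, hr.2]

theorem isCompact : IsCompact {μ | DualFeasible n y C μ} := by
  have : {μ | DualFeasible n y C μ} = Set.Icc 0 (fun _ => C) ∩ {μ | ∑ i, y i * μ i = 0} := by
    ext μ
    simp [DualFeasible, Pi.le_def, forall_and]
  rw [this]
  exact isCompact_Icc.inter_right (isClosed_eq (by fun_prop) (by fun_prop))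

end DualFeasible

/-- The active constraints at `μ`: the coordinates at the lower bound and those at the upper
bound of the box. -/
def activeSets {n : ℕ} (C : ℝ) (μ : Fin n → ℝ) : Set (Fin n) × Set (Fin n) :=
  ({i | μ i = 0}, {i | μ i = C})

theorem activeSets_add_smul_sub {n : ℕ} {y : Fin n → ℝ} {C : ℝ} {μ ν : Fin n → ℝ}
    (hμ : DualFeasible n y C μ) (hν : DualFeasible n y C ν)
    (h : activeSets C μ = activeSets C ν) {r : ℝ} (hr : r ∈ Set.Icc (0 : ℝ) 1) :
    activeSets C (μ + r • (ν - μ)) = activeSets C μ := by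
  obtain ⟨h0, hC⟩ := Prod.ext_iff.1 h
  have h0 : ∀ i, μ i = 0 ↔ ν i = 0 := fun i => Set.ext_iff.1 h0 i
  have hC : ∀ i, μ i = C ↔ ν i = C := fun i => Set.ext_iff.1 hC i
  have hcomb : ∀ i, (μ + r • (ν - μ)) i = (1 - r) * μ i + r * ν i := fun i => by
    simp only [Pi.add_apply, Pi.smul_apply, Pi.sub_apply, smul_eq_mul]
    ring
  refine Prod.ext (Set.ext fun i => ?_) (Set.ext fun i => ?_)
  · change (μ + r • (ν - μ)) i = 0 ↔ μ i = 0
    rw [hcomb]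
    refine ⟨fun hi => ?_, fun hi => by rw [(h0 i).1 hi, hi]; ring⟩
    by_contra hne
    have h1 : 0 < μ i := lt_of_le_of_ne (hμ.1 i).1 (Ne.symm hne)
    have h2 : 0 < ν i := lt_of_le_of_ne (hν.1 i).1 (Ne.symm fun hi => hne ((h0 i).2 hi))
    rcases hr.1.eq_or_lt with rfl | hr0
    · linarith
    · nlinarith [mul_pos hr0 h2, hr.2]
  · change (μ + r • (ν - μ)) i = C ↔ μ i = C
    rw [hcomb]
    refine ⟨fun hi => ?_, fun hi => by rw [(hC i).1 hi, hi]; ring⟩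
    by_contra hne
    have h1 : μ i < C := lt_of_le_of_ne (hμ.1 i).2 hne
    have h2 : ν i < C := lt_of_le_of_ne (hν.1 i).2 fun hi => hne ((hC i).2 hi)
    rcases hr.1.eq_or_lt with rfl | hr0
    · linarith
    · nlinarith [mul_pos hr0 (sub_pos.2 h2), hr.2]

open Filter Topology in
/-- If `μ` and `ν` have the same active constraints, the segment from `ν` to `μ` can be prolonged
beyond `μ` inside the feasible set. -/
theorem exists_dualFeasible_prolong {n : ℕ} {y : Fin n → ℝ} {C : ℝ} {μ ν : Fin n → ℝ}
    (hμ : DualFeasible n y C μ) (hν : DualFeasible n y C ν)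
    (h : activeSets C μ = activeSets C ν) :
    ∃ r < (0 : ℝ), DualFeasible n y C (μ + r • (ν - μ)) := by
  obtain ⟨h0, hC⟩ := Prod.ext_iff.1 h
  have h0 : ∀ i, μ i = 0 ↔ ν i = 0 := fun i => Set.ext_iff.1 h0 i
  have hC : ∀ i, μ i = C ↔ ν i = C := fun i => Set.ext_iff.1 hC i
  have hcont : ∀ i, Tendsto (fun r : ℝ => (μ + r • (ν - μ)) i) (𝓝[<] 0) (𝓝 (μ i)) := by
    intro i
    have : Continuous fun r : ℝ => (μ + r • (ν - μ)) i := by fun_prop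
    simpa using (this.tendsto 0).mono_left nhdsWithin_le_nhds
  have hev : ∀ᶠ r : ℝ in 𝓝[<] 0,
      ∀ i, 0 ≤ (μ + r • (ν - μ)) i ∧ (μ + r • (ν - μ)) i ≤ C := by
    refine eventually_all.2 fun i => Eventually.and ?_ ?_
    · by_cases hi : μ i = 0
      · exact Eventually.of_forall fun r => by simp [hi, (h0 i).1 hi]
      · have h1 : 0 < μ i := lt_of_le_of_ne (hμ.1 i).1 (Ne.symm hi)
        exact ((hcont i).eventually_const_lt h1).mono fun r hr => hr.le
    · by_cases hi : μ i = C
      · exact Eventually.of_forall fun r => by simp [hi, (hC i).1 hi]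
      · have h1 : μ i < C := lt_of_le_of_ne (hμ.1 i).2 hi
        exact ((hcont i).eventually_lt_const h1).mono fun r hr => hr.le
  obtain ⟨r, hr, hr0⟩ := (hev.and self_mem_nhdsWithin).exists
  exact ⟨r, hr0, hr, hμ.sum_add_smul_sub hν r⟩

/-- The gradient of the dual objective. -/
noncomputable def dualGrad {n : ℕ} (Q : Matrix (Fin n) (Fin n) ℝ) (q : Fin n → ℝ)
    (ε : ℝ) (μ : Fin n → ℝ) : Fin n → ℝ :=
  Q.mulVec μ - 1 + ε • q

section Objective

variable {n : ℕ} {Q : Matrix (Fin n) (Fin n) ℝ} {q y : Fin n → ℝ} {C ε : ℝ}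

theorem dualObj_add (hQ : Q.IsSymm) (μ d : Fin n → ℝ) :
    dualObj n Q q ε (μ + d) =
      dualObj n Q q ε μ + dualGrad Q q ε μ ⬝ᵥ d + (1 / 2) * (d ⬝ᵥ Q.mulVec d) := by
  have hsymm : d ⬝ᵥ Q.mulVec μ = μ ⬝ᵥ Q.mulVec d := by
    rw [dotProduct_mulVec, ← mulVec_transpose, hQ.eq, dotProduct_comm]
  have hsum : ∀ v : Fin n → ℝ, ∑ i, v i = 1 ⬝ᵥ v := fun v => by simp [dotProduct]
  simp only [dualObj, dualGrad, hsum, mulVec_add, dotProduct_add, add_dotProduct, sub_dotProduct,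
    smul_dotProduct, smul_eq_mul, hsymm, dotProduct_comm (Q.mulVec μ) d]
  ring

theorem dualGrad_interpolate (ε δ r : ℝ) (μ ν : Fin n → ℝ) :
    dualGrad Q q (ε + r * (δ - ε)) (μ + r • (ν - μ)) =
      (1 - r) • dualGrad Q q ε μ + r • dualGrad Q q δ ν := by
  ext i
  simp only [dualGrad, mulVec_add, mulVec_smul, mulVec_sub, Pi.add_apply, Pi.sub_apply,
    Pi.smul_apply, smul_eq_mul, Pi.one_apply]
  ring

theorem quadForm_nonneg (hQ : Q.PosDef) (d : Fin n → ℝ) : 0 ≤ d ⬝ᵥ Q.mulVec d := by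
  simpa using hQ.posSemidef.dotProduct_mulVec_nonneg d

/-- First-order characterization of the minimizers of the dual problem. -/
theorem dualObj_isMin_iff (hQs : Q.IsSymm) (hQ : Q.PosDef) {μ : Fin n → ℝ}
    (hμ : DualFeasible n y C μ) :
    (∀ ν, DualFeasible n y C ν → dualObj n Q q ε μ ≤ dualObj n Q q ε ν) ↔
      ∀ ν, DualFeasible n y C ν → 0 ≤ dualGrad Q q ε μ ⬝ᵥ (ν - μ) := by
  constructor
  · intro hmin ν hν
    by_contra! hneg
    set g := dualGrad Q q ε μ ⬝ᵥ (ν - μ) with hg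
    set D := (ν - μ) ⬝ᵥ Q.mulVec (ν - μ) with hD
    have hD0 : 0 ≤ D := quadForm_nonneg hQ _
    have hpos : 0 < D - g := by linarith
    have hr0 : 0 < -g / (D - g) := div_pos (by linarith) hpos
    have hr1 : -g / (D - g) ≤ 1 := (div_le_one hpos).2 (by linarith)
    have hr : -g / (D - g) * (D - g) = -g := div_mul_cancel₀ _ hpos.ne'
    set r := -g / (D - g)
    have hle := hmin _ (hμ.add_smul_sub hν ⟨hr0.le, hr1⟩)
    rw [dualObj_add hQs, mulVec_smul, dotProduct_smul, dotProduct_smul, smul_dotProduct,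
      ← hg, ← hD] at hle
    simp only [smul_eq_mul] at hle
    have hle' : 0 ≤ r * (g + (1 / 2) * (r * D)) := by nlinarith
    have := nonneg_of_mul_nonneg_right hle' hr0
    nlinarith
  · intro h ν hν
    have := dualObj_add (q := q) (ε := ε) hQs μ (ν - μ)
    rw [add_sub_cancel] at this
    linarith [h ν hν, quadForm_nonneg hQ (ν - μ)]

theorem dualObj_min_unique (hQs : Q.IsSymm) (hQ : Q.PosDef) {μ ν : Fin n → ℝ}
    (hμ : DualFeasible n y C μ)
    (hmin : ∀ ρ, DualFeasible n y C ρ → dualObj n Q q ε μ ≤ dualObj n Q q ε ρ)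
    (hν : DualFeasible n y C ν)
    (hmin' : ∀ ρ, DualFeasible n y C ρ → dualObj n Q q ε ν ≤ dualObj n Q q ε ρ) : ν = μ := by
  by_contra hne
  have hexp := dualObj_add (q := q) (ε := ε) hQs μ (ν - μ)
  rw [add_sub_cancel] at hexp
  have hpos : 0 < (ν - μ) ⬝ᵥ Q.mulVec (ν - μ) := by
    simpa using hQ.dotProduct_mulVec_pos (sub_ne_zero.2 hne)
  linarith [(dualObj_isMin_iff hQs hQ hμ).1 hmin ν hν, hmin' μ hμ]

theorem continuous_dualObj :
    Continuous fun p : ℝ × (Fin n → ℝ) => dualObj n Q q p.1 p.2 := by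
  unfold dualObj
  fun_prop

open Filter Topology in
theorem continuous_of_isMin (hQs : Q.IsSymm) (hQ : Q.PosDef) {f : ℝ → Fin n → ℝ}
    (hf : ∀ ε, DualFeasible n y C (f ε))
    (hmin : ∀ ε ν, DualFeasible n y C ν → dualObj n Q q ε (f ε) ≤ dualObj n Q q ε ν) :
    Continuous f := by
  refine continuous_iff_continuousAt.2 fun ε => ?_
  refine DualFeasible.isCompact.tendsto_nhds_of_unique_mapClusterPt
    (Eventually.of_forall hf) fun μ hμ hcl => ?_
  obtain ⟨U, hU, hlim⟩ := mapClusterPt_iff_ultrafilter.1 hcl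
  refine dualObj_min_unique hQs hQ (hf ε) (hmin ε) hμ fun ρ hρ => ?_
  have hid : Tendsto (fun t : ℝ => t) U (𝓝 ε) := hU
  exact le_of_tendsto_of_tendsto'
    ((continuous_dualObj.tendsto (ε, μ)).comp (hid.prodMk_nhds hlim))
    ((continuous_dualObj.tendsto (ε, ρ)).comp (hid.prodMk_nhds tendsto_const_nhds))
    fun t => hmin t ρ hρ

/-- At a minimizer, the gradient is orthogonal to the directions towards feasible points with the
same active constraints. -/
theorem dualGrad_dotProduct_eq_zero (hQs : Q.IsSymm) (hQ : Q.PosDef) {μ ν : Fin n → ℝ}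
    (hμ : DualFeasible n y C μ)
    (hmin : ∀ ρ, DualFeasible n y C ρ → dualObj n Q q ε μ ≤ dualObj n Q q ε ρ)
    (hν : DualFeasible n y C ν) (h : activeSets C μ = activeSets C ν) :
    dualGrad Q q ε μ ⬝ᵥ (ν - μ) = 0 := by
  have hvi := (dualObj_isMin_iff hQs hQ hμ).1 hmin
  obtain ⟨r, hr, hfeas⟩ := exists_dualFeasible_prolong hμ hν h
  have h1 := hvi _ hfeas
  rw [add_sub_cancel_left, dotProduct_smul, smul_eq_mul] at h1
  nlinarith [hvi ν hν]

/-- Between two parameters whose minimizers have the same active constraints, the minimizers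
are obtained by linear interpolation. -/
theorem dualObj_isMin_interpolate (hQs : Q.IsSymm) (hQ : Q.PosDef) {δ : ℝ} {μ ν : Fin n → ℝ}
    (hμ : DualFeasible n y C μ)
    (hμmin : ∀ ρ, DualFeasible n y C ρ → dualObj n Q q ε μ ≤ dualObj n Q q ε ρ)
    (hν : DualFeasible n y C ν)
    (hνmin : ∀ ρ, DualFeasible n y C ρ → dualObj n Q q δ ν ≤ dualObj n Q q δ ρ)
    (h : activeSets C μ = activeSets C ν) {r : ℝ} (hr : r ∈ Set.Icc (0 : ℝ) 1) :
    ∀ ρ, DualFeasible n y C ρ → dualObj n Q q (ε + r * (δ - ε)) (μ + r • (ν - μ)) ≤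
      dualObj n Q q (ε + r * (δ - ε)) ρ := by
  rw [dualObj_isMin_iff hQs hQ (hμ.add_smul_sub hν hr)]
  intro ρ hρ
  have h1 := (dualObj_isMin_iff hQs hQ hμ).1 hμmin ρ hρ
  have h2 := (dualObj_isMin_iff hQs hQ hν).1 hνmin ρ hρ
  have h3 := dualGrad_dotProduct_eq_zero hQs hQ hμ hμmin hν h
  have h4 := dualGrad_dotProduct_eq_zero hQs hQ hν hνmin hμ h.symm
  rw [dualGrad_interpolate]
  simp only [add_dotProduct, smul_dotProduct, dotProduct_sub, dotProduct_add, dotProduct_smul,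
    smul_eq_mul] at *
  have hr' : 0 ≤ 1 - r := by linarith [hr.2]
  have h5 := mul_nonneg hr' h1
  have h6 := mul_nonneg hr.1 h2
  linear_combination h5 + h6 + r * (1 - r) * h3 + r * (1 - r) * h4

end Objective

/-- The solution path `ε ↦ μ(ε)` of the parametric quadratic program
is continuous and piecewise affine: there is a finite set `T` of breakpoints such that on
every closed interval whose interior avoids `T`, the path agrees with an affine function
of `ε`. -/
theorem parametric_qp_piecewise_affine
    (n : ℕ) (hn : 1 ≤ n)
    (Q : Matrix (Fin n) (Fin n) ℝ) (hQsymm : Q.IsSymm) (hQpd : Q.PosDef)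
    (q y : Fin n → ℝ) (C : ℝ) (hC : 0 < C) :
    ∃ μpath : ℝ → (Fin n → ℝ),
      (∀ ε : ℝ,
        DualFeasible n y C (μpath ε) ∧
        (∀ ν : Fin n → ℝ, DualFeasible n y C ν →
          dualObj n Q q ε (μpath ε) ≤ dualObj n Q q ε ν) ∧
        (∀ ν : Fin n → ℝ, DualFeasible n y C ν →
          (∀ ρ : Fin n → ℝ, DualFeasible n y C ρ → dualObj n Q q ε ν ≤ dualObj n Q q ε ρ) →
          ν = μpath ε)) ∧
      Continuous μpath ∧
      ∃ T : Finset ℝ, ∀ ε₀ ε₁ : ℝ, ε₀ < ε₁ → (∀ t ∈ T, t ∉ Set.Ioo ε₀ ε₁) →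
        ∃ a v : Fin n → ℝ, ∀ ε ∈ Set.Icc ε₀ ε₁, μpath ε = fun i => a i + ε * v i := by
  have hex : ∀ ε : ℝ, ∃ μ, DualFeasible n y C μ ∧
      ∀ ν, DualFeasible n y C ν → dualObj n Q q ε μ ≤ dualObj n Q q ε ν := fun ε =>
    DualFeasible.isCompact.exists_isMinOn ⟨0, DualFeasible.zero hC.le⟩
      (continuous_dualObj.comp (Continuous.prodMk_right ε)).continuousOn
  choose f hf hmin using hex
  have huniq : ∀ ε ν, DualFeasible n y C ν →
      (∀ ρ, DualFeasible n y C ρ → dualObj n Q q ε ν ≤ dualObj n Q q ε ρ) → ν = f ε :=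
    fun ε ν => dualObj_min_unique hQsymm hQpd (hf ε) (hmin ε)
  have hcont : Continuous f := continuous_of_isMin hQsymm hQpd hf hmin
  have hinterp : ∀ s t, activeSets C (f s) = activeSets C (f t) → ∀ r ∈ Set.Icc (0 : ℝ) 1,
      f (s + r * (t - s)) = f s + r • (f t - f s) := fun s t hst r hr =>
    (huniq _ _ ((hf s).add_smul_sub (hf t) hr)
      (dualObj_isMin_interpolate hQsymm hQpd (hf s) (hmin s) (hf t) (hmin t) hst hr)).symm
  refine ⟨f, fun ε => ⟨hf ε, hmin ε, huniq ε⟩, hcont, ?_⟩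
  obtain ⟨T, hT⟩ := exists_finset_forall_Ioo_eq (fun ε => activeSets C (f ε)) (by
    intro s t hst x hx
    rcases (hx.1.trans hx.2).eq_or_lt with rfl | hlt
    · rw [le_antisymm hx.2 hx.1]
    have hpos : 0 < t - s := sub_pos.2 hlt
    have hr : (x - s) / (t - s) ∈ Set.Icc (0 : ℝ) 1 :=
      ⟨div_nonneg (sub_nonneg.2 hx.1) hpos.le, (div_le_one hpos).2 (by linarith [hx.2])⟩
    have hfx := hinterp s t hst _ hr
    rw [div_mul_cancel₀ _ hpos.ne', add_sub_cancel] at hfx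
    change activeSets C (f x) = activeSets C (f s)
    rw [hfx]
    exact activeSets_add_smul_sub (hf s) (hf t) hst hr)
  exact ⟨T, fun ε₀ ε₁ hlt hav => exists_affine_on_Icc hcont hlt fun s hs t ht =>
    hinterp s t (hT ε₀ ε₁ hav s hs t ht)⟩
end
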